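/- Let f = (1/2)·1_{[−1,1]} be the uniform density on [−1,1]. Then for every permutation π of {1,…,n+1}, P(f,π) = (1/2^n) · λ(P_π), where λ is Lebesgue measure on ℝ^n. -/

import Mathlib

open MeasureTheory

noncomputable section

/-- Walk positions: `walk n x i = x 0 + ⋯ + x (i-1)` (so `walk n x 0 = 0`). -/
def walk (n : ℕ) (x : Fin n → ℝ) (i : Fin (n + 1)) : ℝ :=
  ∑ j : Fin n, if (j : ℕ) < (i : ℕ) then x j else 0

/-- The region of step tuples generating the ordinal pattern `π`. -/
def D (n : ℕ) (π : Equiv.Perm (Fin (n + 1))) : Set (Fin n → ℝ) :=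
  {x | (∀ i j : Fin (n + 1), i ≠ j → walk n x i ≠ walk n x j) ∧
       (∀ i j : Fin (n + 1), walk n x i < walk n x j ↔ π i < π j)}

/-- The matrix `L_π`. -/
def L (n : ℕ) (π : Equiv.Perm (Fin (n + 1))) : Matrix (Fin n) (Fin n) ℝ :=
  fun i j =>
    if (π i.castSucc : ℕ) ≤ (j : ℕ) ∧ (j : ℕ) < (π i.succ : ℕ) then 1
    else if (π i.succ : ℕ) ≤ (j : ℕ) ∧ (j : ℕ) < (π i.castSucc : ℕ) then -1
    else 0

/-- Partial sum `x i + x (i+1) + ⋯ + x (j-1)`. -/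
def psum (n : ℕ) (x : Fin n → ℝ) (i j : Fin (n + 1)) : ℝ :=
  ∑ k : Fin n, if (i : ℕ) ≤ (k : ℕ) ∧ (k : ℕ) < (j : ℕ) then x k else 0

/-- The level count `lev(π)_j`. -/
def lev (n : ℕ) (π : Equiv.Perm (Fin (n + 1))) (j : Fin n) : ℕ :=
  (Finset.univ.filter fun i : Fin n =>
    ((π i.castSucc : ℕ) ≤ (j : ℕ) ∧ (j : ℕ) < (π i.succ : ℕ)) ∨
    ((π i.succ : ℕ) ≤ (j : ℕ) ∧ (j : ℕ) < (π i.castSucc : ℕ))).card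

/-- The polytope of steps `P_π`. -/
def Ppoly (n : ℕ) (π : Equiv.Perm (Fin (n + 1))) : Set (Fin n → ℝ) :=
  {x | (∀ i, 0 ≤ x i) ∧ ∀ i : Fin n,
    psum n x (min (π i.castSucc) (π i.succ)) (max (π i.castSucc) (π i.succ)) ≤ 1}

/-- The set of positive roots, identified with pairs `i < j`. -/
def PosRoot (n : ℕ) := {p : Fin (n + 1) × Fin (n + 1) // p.1 < p.2}

/-- The Shi condition for an alcove address. -/
def Shi (n : ℕ) (k : PosRoot n → ℤ) : Prop :=
  ∀ (i t j : Fin (n + 1)) (hit : i < t) (htj : t < j),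
    k ⟨(i, t), hit⟩ + k ⟨(t, j), htj⟩ ≤ k ⟨(i, j), hit.trans htj⟩ ∧
    k ⟨(i, j), hit.trans htj⟩ ≤ k ⟨(i, t), hit⟩ + k ⟨(t, j), htj⟩ + 1

/-- The alcove with address `k`, in step coordinates. -/
def alcove (n : ℕ) (k : PosRoot n → ℤ) : Set (Fin n → ℝ) :=
  {x | ∀ p : PosRoot n,
    (k p : ℝ) < psum n x p.1.1 p.1.2 ∧ psum n x p.1.1 p.1.2 < (k p : ℝ) + 1}

/-- The root ideal `I_π`. -/
def rootIdeal (n : ℕ) (π : Equiv.Perm (Fin (n + 1))) : Set (PosRoot n) :=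
  {p | ∃ c : Fin n,
    min (π c.castSucc : ℕ) (π c.succ : ℕ) ≤ (p.1.1 : ℕ) ∧
    (p.1.2 : ℕ) ≤ max (π c.castSucc : ℕ) (π c.succ : ℕ)}

/-- The level count matrix `lev(π)_{i,j}`. -/
def lev2 (n : ℕ) (π : Equiv.Perm (Fin (n + 1))) (i j : Fin n) : ℕ :=
  (Finset.univ.filter fun k : Fin n =>
    ((π k.castSucc : ℕ) ≤ (i : ℕ) ∧ (π k.castSucc : ℕ) ≤ (j : ℕ) ∧
     (i : ℕ) < (π k.succ : ℕ) ∧ (j : ℕ) < (π k.succ : ℕ)) ∨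
    ((π k.succ : ℕ) ≤ (i : ℕ) ∧ (π k.succ : ℕ) ≤ (j : ℕ) ∧
     (i : ℕ) < (π k.castSucc : ℕ) ∧ (j : ℕ) < (π k.castSucc : ℕ))).card

section StepMap

variable {n : ℕ}

lemma walk_zero (x : Fin n → ℝ) : walk n x 0 = 0 := by
  simp [walk]

lemma walk_succ (x : Fin n → ℝ) (i : Fin n) :
    walk n x i.succ = walk n x i.castSucc + x i := by
  have h : x i = ∑ j : Fin n, if j = i then x j else 0 := by simp
  rw [h, walk, walk, ← Finset.sum_add_distrib]
  refine Finset.sum_congr rfl fun j _ => ?_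
  simp only [Fin.val_succ, Fin.val_castSucc, Fin.ext_iff]
  split_ifs <;> first | omega | simp

lemma walk_add (x y : Fin n → ℝ) (i : Fin (n + 1)) :
    walk n (x + y) i = walk n x i + walk n y i := by
  rw [walk, walk, walk, ← Finset.sum_add_distrib]
  refine Finset.sum_congr rfl fun j _ => ?_
  split_ifs <;> simp

lemma walk_smul (c : ℝ) (x : Fin n → ℝ) (i : Fin (n + 1)) :
    walk n (c • x) i = c * walk n x i := by
  simp [walk, Finset.mul_sum]

lemma psum_eq_walk_sub (x : Fin n → ℝ) {i j : Fin (n + 1)} (hij : i ≤ j) :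
    psum n x i j = walk n x j - walk n x i := by
  have hij' : (i : ℕ) ≤ j := hij
  rw [psum, walk, walk, ← Finset.sum_sub_distrib]
  refine Finset.sum_congr rfl fun k _ => ?_
  split_ifs <;> first | omega | simp

lemma walk_strictMono {y : Fin n → ℝ} (hy : ∀ i, 0 < y i) : StrictMono (walk n y) :=
  Fin.strictMono_iff_lt_succ.2 fun i => by
    rw [walk_succ]
    linarith [hy i]

/-- The increments of the walk with steps `y` when its positions are visited in the order
`σ 0, σ 1, …, σ n`. -/
def stepMap (σ : Equiv.Perm (Fin (n + 1))) : (Fin n → ℝ) →ₗ[ℝ] (Fin n → ℝ) where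
  toFun y i := walk n y (σ i.succ) - walk n y (σ i.castSucc)
  map_add' x y := by
    ext i
    simp only [walk_add, Pi.add_apply]
    ring
  map_smul' c x := by
    ext i
    simp only [walk_smul, Pi.smul_apply, smul_eq_mul, RingHom.id_apply]
    ring

lemma stepMap_apply (σ : Equiv.Perm (Fin (n + 1))) (y : Fin n → ℝ) (i : Fin n) :
    stepMap σ y i = walk n y (σ i.succ) - walk n y (σ i.castSucc) := rfl

lemma walk_stepMap (σ : Equiv.Perm (Fin (n + 1))) (y : Fin n → ℝ) (i : Fin (n + 1)) :
    walk n (stepMap σ y) i = walk n y (σ i) - walk n y (σ 0) := by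
  induction i using Fin.induction with
  | zero => simp [walk_zero]
  | succ i ih => rw [walk_succ, ih, stepMap_apply]; ring

lemma stepMap_mul (σ τ : Equiv.Perm (Fin (n + 1))) :
    stepMap (σ * τ) = stepMap τ * stepMap σ := by
  ext1 y
  ext i
  simp [stepMap_apply, walk_stepMap]

lemma stepMap_one : stepMap (1 : Equiv.Perm (Fin (n + 1))) = 1 := by
  ext1 y
  ext i
  simp [stepMap_apply, walk_succ]

lemma stepMap_pow (σ : Equiv.Perm (Fin (n + 1))) (k : ℕ) :
    stepMap (σ ^ k) = stepMap σ ^ k := by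
  induction k with
  | zero => simp [stepMap_one]
  | succ k ih => rw [pow_succ, stepMap_mul, ih, pow_succ']

lemma abs_det_stepMap (σ : Equiv.Perm (Fin (n + 1))) :
    |LinearMap.det (stepMap σ)| = 1 := by
  have h : |LinearMap.det (stepMap σ)| ^ orderOf σ = 1 := by
    rw [← abs_pow, ← map_pow, ← stepMap_pow, pow_orderOf_eq_one, stepMap_one, map_one, abs_one]
  exact (pow_eq_one_iff_of_nonneg (abs_nonneg _) (orderOf_pos σ).ne').1 h

lemma volume_preimage_stepMap (σ : Equiv.Perm (Fin (n + 1))) (s : Set (Fin n → ℝ)) :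
    volume (stepMap σ ⁻¹' s) = volume s := by
  have h0 : LinearMap.det (stepMap σ) ≠ 0 := by
    rw [← abs_pos, abs_det_stepMap]
    exact one_pos
  rw [Measure.addHaar_preimage_linearMap _ h0, abs_inv, abs_det_stepMap]
  simp

lemma stepMap_stepMap_inv (σ : Equiv.Perm (Fin (n + 1))) (x : Fin n → ℝ) :
    stepMap σ (stepMap σ⁻¹ x) = x := by
  rw [← Module.End.mul_apply, ← stepMap_mul, inv_mul_cancel, stepMap_one, Module.End.one_apply]

lemma mem_D_iff (π : Equiv.Perm (Fin (n + 1))) (x : Fin n → ℝ) :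
    x ∈ D n π ↔ ∀ j, 0 < stepMap π⁻¹ x j := by
  constructor
  · rintro ⟨-, h⟩ j
    rw [stepMap_apply, sub_pos, h]
    simp
  · intro h
    have hwalk : ∀ i, walk n x i =
        walk n (stepMap π⁻¹ x) (π i) - walk n (stepMap π⁻¹ x) (π 0) := fun i => by
      rw [← walk_stepMap, stepMap_stepMap_inv]
    have key : ∀ i j, walk n x i < walk n x j ↔ π i < π j := fun i j => by
      rw [hwalk i, hwalk j, sub_lt_sub_iff_right, (walk_strictMono h).lt_iff_lt]
    refine ⟨fun i j hij hw => hij (π.injective (le_antisymm ?_ ?_)), key⟩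
    · rw [← not_lt, ← key, hw]
      exact lt_irrefl _
    · rw [← not_lt, ← key, hw]
      exact lt_irrefl _

lemma psum_min_max_eq_abs_stepMap (π : Equiv.Perm (Fin (n + 1))) {y : Fin n → ℝ}
    (hy : ∀ i, 0 < y i) (i : Fin n) :
    psum n y (min (π i.castSucc) (π i.succ)) (max (π i.castSucc) (π i.succ)) =
      |stepMap π y i| := by
  have hmono := (walk_strictMono hy).monotone
  rw [psum_eq_walk_sub y min_le_max, hmono.map_max, hmono.map_min, max_sub_min_eq_abs,
    stepMap_apply]

lemma D_inter_cube_eq_preimage (π : Equiv.Perm (Fin (n + 1))) :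
    D n π ∩ {x | ∀ i, -1 ≤ x i ∧ x i ≤ 1} =
      stepMap π⁻¹ ⁻¹' ({y | ∀ i, 0 < y i} ∩ Ppoly n π) := by
  ext x
  simp only [Set.mem_inter_iff, mem_D_iff, Set.mem_preimage, Set.mem_ofPred_eq, Ppoly]
  refine and_congr_right fun h => ?_
  rw [and_iff_right fun i => (h i).le]
  refine forall_congr' fun i => ?_
  rw [psum_min_max_eq_abs_stepMap π h, stepMap_stepMap_inv, abs_le]

lemma volume_pos_inter_Ppoly (π : Equiv.Perm (Fin (n + 1))) :
    volume ({y | ∀ i, 0 < y i} ∩ Ppoly n π) = volume (Ppoly n π) := by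
  refine measure_congr ?_
  have hne : ∀ᵐ y : Fin n → ℝ, ∀ i, y i ≠ 0 := by
    refine ae_all_iff.2 fun i => ?_
    rw [ae_iff]
    simp only [not_not]
    exact Measure.pi_hyperplane (fun _ : Fin n => (volume : Measure ℝ)) i 0
  filter_upwards [hne] with y hy
  refine propext ⟨fun h => h.2, fun h => ⟨fun i => (h.1 i).lt_of_ne (hy i).symm, h⟩⟩

lemma prod_uniform_eq_indicator :
    (fun x : Fin n → ℝ => ∏ i : Fin n, (if -1 ≤ x i ∧ x i ≤ 1 then (1 : ℝ) / 2 else 0)) =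
      {x : Fin n → ℝ | ∀ i, -1 ≤ x i ∧ x i ≤ 1}.indicator fun _ => 1 / 2 ^ n := by
  ext x
  rw [Finset.prod_ite_zero]
  simp [Set.indicator]

end StepMap

/-- for the uniform density on `[-1,1]`,
`P(f,π) = (1/2^n) · λ(P_π)`. -/
theorem stmt_9 (n : ℕ) (hn : 1 ≤ n) (π : Equiv.Perm (Fin (n + 1))) :
    ∫ x in D n π, ∏ i : Fin n, (if -1 ≤ x i ∧ x i ≤ 1 then (1 : ℝ) / 2 else 0) =
    (1 / 2 ^ n) * (volume (Ppoly n π)).toReal := by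
  rw [prod_uniform_eq_indicator, setIntegral_indicator (by measurability), setIntegral_const,
    D_inter_cube_eq_preimage, measureReal_def, volume_preimage_stepMap, volume_pos_inter_Ppoly,
    smul_eq_mul, mul_comm]
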